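/- Let ε = e^{iπ/4}, ω = e^{2πi/3}, R = ℤ[ε, ω] ⊆ ℂ, and let S = (1/√2)·[[−1, i], [−i, 1]], T = (1/√2)·[[ε, ε], [ε³, ε⁷]], U = (1/√2)·[[1, 1], [i, 1]]. Let G_8 be the subgroup of GL_2(ℂ) generated by U(εS)U^{−1} and U T U^{−1} (these matrices have entries in R). Then the ring of invariants R[x, y]^{G_8} is not isomorphic to a polynomial ring over R. -/

import Mathlib

set_option synthInstance.maxHeartbeats 1000000
set_option maxHeartbeats 1000000

open MvPolynomial Complex

/-- `ε = e^{iπ/4}`, a primitive eighth root of unity. -/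
noncomputable def ε : ℂ := Complex.exp (Real.pi * Complex.I / 4)

/-- `ω = e^{2πi/3}`, a primitive third root of unity. -/
noncomputable def ω : ℂ := Complex.exp (2 * Real.pi * Complex.I / 3)

/-- `S = (1/√2)·[[−1, i], [−i, 1]]`. -/
noncomputable def Smat : Matrix (Fin 2) (Fin 2) ℂ :=
  ((Real.sqrt 2 : ℂ))⁻¹ • !![-1, I; -I, 1]

/-- `T = (1/√2)·[[ε, ε], [ε³, ε⁷]]`. -/
noncomputable def Tmat : Matrix (Fin 2) (Fin 2) ℂ :=
  ((Real.sqrt 2 : ℂ))⁻¹ • !![ε, ε; ε^3, ε^7]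

/-- `U = (1/√2)·[[1, 1], [i, 1]]`. -/
noncomputable def Umat : Matrix (Fin 2) (Fin 2) ℂ :=
  ((Real.sqrt 2 : ℂ))⁻¹ • !![1, 1; I, 1]

/-- The ring `R = ℤ[ε, ω] ⊆ ℂ`. -/
noncomputable def Rring : Subring ℂ := Subring.closure {ε, ω}

/-- The algebra endomorphism of `ℂ[x, y]` given by the linear substitution
`x_i ↦ ∑_j M_{i,j} x_j` for a matrix `M`. -/
noncomputable def actC (M : Matrix (Fin 2) (Fin 2) ℂ) :
    MvPolynomial (Fin 2) ℂ →ₐ[ℂ] MvPolynomial (Fin 2) ℂ :=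
  aeval fun i => ∑ j, C (M i j) * X j

/-- For a subring `R ⊆ ℂ` and a subgroup `G ⊆ GL_2(ℂ)`, the invariant ring `R[x, y]^G`:
the `R`-subalgebra of `ℂ[x, y]` consisting of the polynomials with all coefficients in `R`
that are fixed by the substitution action of every element of `G`. -/
noncomputable def invariantRingC (R : Subring ℂ) (G : Subgroup (GL (Fin 2) ℂ)) :
    Subalgebra ↥R (MvPolynomial (Fin 2) ℂ) :=
  (MvPolynomial.mapAlgHom (R := ↥R) (σ := Fin 2) (Algebra.ofId ↥R ℂ)).range ⊓
    Subalgebra.restrictScalars ↥R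
      (⨅ g ∈ G, AlgHom.equalizer (actC (g : Matrix (Fin 2) (Fin 2) ℂ)) (AlgHom.id ℂ _))

/-- The variable `x`. -/
noncomputable def xv : MvPolynomial (Fin 2) ℂ := X 0
/-- The variable `y`. -/
noncomputable def yv : MvPolynomial (Fin 2) ℂ := X 1

/-- `f = (i+1)x⁵y − 5x⁴y² + 5(1−i)x³y³ + 5i x²y⁴ − (i+1)xy⁵`. -/
noncomputable def fpoly : MvPolynomial (Fin 2) ℂ :=
  C (I + 1) * xv^5 * yv - 5 * xv^4 * yv^2 + C (5*(1 - I)) * xv^3 * yv^3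
    + C (5*I) * xv^2 * yv^4 - C (I + 1) * xv * yv^5

/-- `g = x⁸ + 4(i−1)x⁷y − 14i x⁶y² + 14(i+1)x⁵y³ − 21x⁴y⁴ + 14(1−i)x³y⁵ + 14i x²y⁶
      − 4(i+1)xy⁷ + y⁸`. -/
noncomputable def gpoly : MvPolynomial (Fin 2) ℂ :=
  xv^8 + C (4*(I - 1)) * xv^7 * yv - C (14*I) * xv^6 * yv^2 + C (14*(I + 1)) * xv^5 * yv^3
    - 21 * xv^4 * yv^4 + C (14*(1 - I)) * xv^3 * yv^5 + C (14*I) * xv^2 * yv^6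
    - C (4*(I + 1)) * xv * yv^7 + yv^8

/-- `h = 2x¹² + 12(i−1)x¹¹y − 66i x¹⁰y² + 110(i+1)x⁹y³ − 231x⁸y⁴ + 132(1−i)x⁷y⁵
      + 132(i+1)x⁵y⁷ − 231x⁴y⁸ + 110(1−i)x³y⁹ + 66i x²y¹⁰ − 12(i+1)xy¹¹ + 2y¹²`. -/
noncomputable def hpoly : MvPolynomial (Fin 2) ℂ :=
  2 * xv^12 + C (12*(I - 1)) * xv^11 * yv - C (66*I) * xv^10 * yv^2
    + C (110*(I + 1)) * xv^9 * yv^3 - 231 * xv^8 * yv^4 + C (132*(1 - I)) * xv^7 * yv^5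
    + C (132*(I + 1)) * xv^5 * yv^7 - 231 * xv^4 * yv^8 + C (110*(1 - I)) * xv^3 * yv^9
    + C (66*I) * xv^2 * yv^10 - C (12*(I + 1)) * xv * yv^11 + 2 * yv^12

/-- `G₈`: the subgroup of `GL_2(ℂ)` generated by `U(εS)U⁻¹` and `U T U⁻¹`
(Shephard–Todd group number 8 in its integral reflection representation). -/
noncomputable def G8 : Subgroup (GL (Fin 2) ℂ) :=
  Subgroup.closure {g | (g : Matrix (Fin 2) (Fin 2) ℂ) = Umat * (ε • Smat) * Umat⁻¹ ∨
    (g : Matrix (Fin 2) (Fin 2) ℂ) = Umat * Tmat * Umat⁻¹}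

/-- A semi-invariant of `G₈` of degree 6, as a binary form over a ring in which `j` plays the role
of `i`. -/
def sexticForm {T : Type*} [CommRing T] (j x y : T) : T :=
  (j + 1) * x^5 * y - 5 * x^4 * y^2 + 5 * (1 - j) * x^3 * y^3 + 5 * j * x^2 * y^4
    - (j + 1) * x * y^5

/-- The invariant of `G₈` of degree 8. -/
def octicForm {T : Type*} [CommRing T] (j x y : T) : T :=
  x^8 + 4 * (j - 1) * x^7 * y - 14 * j * x^6 * y^2 + 14 * (j + 1) * x^5 * y^3
    - 21 * x^4 * y^4 + 14 * (1 - j) * x^3 * y^5 + 14 * j * x^2 * y^6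
    - 4 * (j + 1) * x * y^7 + y^8

/-- The invariant of `G₈` of degree 12. -/
def duodecicForm {T : Type*} [CommRing T] (j x y : T) : T :=
  2 * x^12 + 12 * (j - 1) * x^11 * y - 66 * j * x^10 * y^2
    + 110 * (j + 1) * x^9 * y^3 - 231 * x^8 * y^4 + 132 * (1 - j) * x^7 * y^5
    + 132 * (j + 1) * x^5 * y^7 - 231 * x^4 * y^8 + 110 * (1 - j) * x^3 * y^9
    + 66 * j * x^2 * y^10 - 12 * (j + 1) * x * y^11 + 2 * y^12

section Forms

variable {T T' : Type*} [CommRing T] [CommRing T']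

theorem octicForm_reflection {j : T} (hj : j ^ 2 = -1) (x y : T) :
    octicForm j (x + (-1 + j) * y) (x - y) = octicForm j x y := by
  unfold octicForm; grind

theorem octicForm_rotation (j x y : T) : octicForm j y (-x + y) = octicForm j x y := by
  unfold octicForm; ring

theorem duodecicForm_reflection {j : T} (hj : j ^ 2 = -1) (x y : T) :
    duodecicForm j (x + (-1 + j) * y) (x - y) = duodecicForm j x y := by
  unfold duodecicForm; grind

theorem duodecicForm_rotation (j x y : T) : duodecicForm j y (-x + y) = duodecicForm j x y := by
  unfold duodecicForm; ring

theorem sexticForm_relation {j : T} (hj : j ^ 2 = -1) (x y : T) :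
    -27 * sexticForm j x y ^ 4 = duodecicForm j x y ^ 2 - 4 * octicForm j x y ^ 3 := by
  unfold duodecicForm octicForm sexticForm; grind

theorem map_sexticForm (φ : T →+* T') (j x y : T) :
    φ (sexticForm j x y) = sexticForm (φ j) (φ x) (φ y) := by
  simp [sexticForm, map_ofNat]

theorem map_octicForm (φ : T →+* T') (j x y : T) :
    φ (octicForm j x y) = octicForm (φ j) (φ x) (φ y) := by
  simp [octicForm, map_ofNat]

theorem map_duodecicForm (φ : T →+* T') (j x y : T) :
    φ (duodecicForm j x y) = duodecicForm (φ j) (φ x) (φ y) := by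
  simp [duodecicForm, map_ofNat]

end Forms

section LinearSubstitution

variable {T T' : Type*} [CommRing T] [CommRing T']

/-- The substitution `x_i ↦ ∑_j M_{i,j} x_j` over an arbitrary commutative ring. -/
noncomputable def linSubst (M : Matrix (Fin 2) (Fin 2) T) :
    MvPolynomial (Fin 2) T →ₐ[T] MvPolynomial (Fin 2) T :=
  aeval fun i => ∑ j, C (M i j) * X j

theorem actC_eq_linSubst (M : Matrix (Fin 2) (Fin 2) ℂ) : actC M = linSubst M := rfl

@[simp]
theorem linSubst_X (M : Matrix (Fin 2) (Fin 2) T) (i : Fin 2) :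
    linSubst M (X i) = ∑ j, C (M i j) * X j := by
  simp [linSubst]

theorem linSubst_comp (M N : Matrix (Fin 2) (Fin 2) T) :
    (linSubst M).comp (linSubst N) = linSubst (N * M) := by
  ext1 i
  simp only [AlgHom.comp_apply, linSubst_X, map_mul, algHom_C, algebraMap_eq,
    Matrix.mul_apply, Fin.sum_univ_two, map_add]
  ring

theorem linSubst_one : linSubst (1 : Matrix (Fin 2) (Fin 2) T) = AlgHom.id T _ := by
  ext1 i
  simp [Matrix.one_apply, Finset.sum_ite_eq]

theorem map_linSubst (φ : T →+* T') (M : Matrix (Fin 2) (Fin 2) T)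
    (q : MvPolynomial (Fin 2) T) :
    map φ (linSubst M q) = linSubst (M.map φ) (map φ q) := by
  induction q using MvPolynomial.induction_on with
  | C a => simp [algHom_C]
  | add p q hp hq => simp [hp, hq]
  | mul_X p i hp => simp [hp]

theorem pderiv_linSubst (M : Matrix (Fin 2) (Fin 2) T) (j : Fin 2)
    (q : MvPolynomial (Fin 2) T) :
    pderiv j (linSubst M q) = ∑ i, C (M i j) * linSubst M (pderiv i q) := by
  induction q using MvPolynomial.induction_on with
  | C a => simp [algHom_C]
  | add p q hp hq => simp [hp, hq, mul_add, Finset.sum_add_distrib]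
  | mul_X p i hp =>
    simp only [map_mul, Derivation.leibniz, hp, linSubst_X, map_add, pderiv_X, pderiv_C,
      smul_eq_mul, Fin.sum_univ_two]
    fin_cases i <;> fin_cases j <;> simp <;> ring

/-- Restriction of a binary polynomial to the line spanned by `P`. -/
noncomputable def restrictLine (P : Fin 2 → T) : MvPolynomial (Fin 2) T →ₐ[T] Polynomial T :=
  aeval fun i => Polynomial.C (P i) * Polynomial.X

@[simp]
theorem restrictLine_X (P : Fin 2 → T) (i : Fin 2) :
    restrictLine P (X i) = Polynomial.C (P i) * Polynomial.X := by
  simp [restrictLine]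

theorem restrictLine_linSubst (P : Fin 2 → T) (M : Matrix (Fin 2) (Fin 2) T) (c : T)
    (h : M.mulVec P = c • P) (q : MvPolynomial (Fin 2) T) :
    restrictLine P (linSubst M q) =
      (restrictLine P q).comp (Polynomial.C c * Polynomial.X) := by
  induction q using MvPolynomial.induction_on with
  | C a => simp [algHom_C]
  | add p q hp hq => simp [hp, hq]
  | mul_X p i hp =>
    have hi := congrArg (fun t => Polynomial.C t * Polynomial.X) (congrFun h i)
    simp [Matrix.mulVec, dotProduct] at hi
    simp only [map_mul, hp, linSubst_X, Fin.sum_univ_two, map_add, algHom_C, restrictLine_X,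
      Polynomial.mul_comp, Polynomial.C_comp, Polynomial.X_comp, Polynomial.algebraMap_eq]
    linear_combination (restrictLine P p).comp (Polynomial.C c * Polynomial.X) * hi

theorem derivative_restrictLine (P : Fin 2 → T) (q : MvPolynomial (Fin 2) T) :
    (restrictLine P q).derivative = ∑ i, Polynomial.C (P i) * restrictLine P (pderiv i q) := by
  induction q using MvPolynomial.induction_on with
  | C a => simp [algHom_C]
  | add p q hp hq => simp [hp, hq, mul_add, Finset.sum_add_distrib]
  | mul_X p i hp =>
    simp only [map_mul, Derivation.leibniz, hp, restrictLine_X, map_add, pderiv_X,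
      smul_eq_mul, Fin.sum_univ_two, Polynomial.derivative_mul, Polynomial.derivative_C,
      Polynomial.derivative_X]
    fin_cases i <;> simp <;> ring

/-- If `q` is fixed by a matrix fixing `P` and mapping `Q` to `Q + P`, then the restriction of `q`
to the line spanned by `P` has derivative zero. -/
theorem derivative_restrictLine_eq_zero (P Q : Fin 2 → T) (M : Matrix (Fin 2) (Fin 2) T)
    (hP : M.mulVec P = P) (hQ : M.mulVec Q = Q + P) (q : MvPolynomial (Fin 2) T)
    (hq : linSubst M q = q) : (restrictLine P q).derivative = 0 := by
  have hinv (p : MvPolynomial (Fin 2) T) : restrictLine P (linSubst M p) = restrictLine P p := by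
    simpa using restrictLine_linSubst P M 1 (by simpa using hP) p
  have hd (j : Fin 2) : restrictLine P (pderiv j q) =
      ∑ i, Polynomial.C (M i j) * restrictLine P (pderiv i q) := by
    conv_lhs => rw [← hq, pderiv_linSubst]
    simp [hinv, algHom_C]
  have h0 := hd 0
  have h1 := hd 1
  have hQ0 := congrArg Polynomial.C (congrFun hQ 0)
  have hQ1 := congrArg Polynomial.C (congrFun hQ 1)
  simp [Matrix.mulVec, dotProduct] at hQ0 hQ1
  rw [Fin.sum_univ_two] at h0 h1
  rw [derivative_restrictLine, Fin.sum_univ_two]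
  linear_combination -hQ0 * restrictLine P (pderiv 0 q) - hQ1 * restrictLine P (pderiv 1 q)
    - Polynomial.C (Q 0) * h0 - Polynomial.C (Q 1) * h1

end LinearSubstitution

theorem dvd_of_coeff_restrictLine_ne_zero {K : Type*} [Field K] (h3 : (3 : K) = 0) {j : K}
    (hj : j ^ 2 = -1) {q : MvPolynomial (Fin 2) K}
    (hq₁ : linSubst !![1 - j, j; 1, -1 + j] q = q) (hq₂ : linSubst !![-1, 1; -1, 0] q = q)
    {d : ℕ} (hd : (restrictLine ![1, -1] q).coeff d ≠ 0) : 24 ∣ d := by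
  have hchar : CharP K 3 := (CharP.charP_iff_prime_eq_zero Nat.prime_three).2 (by exact_mod_cast h3)
  have h8 : 8 ∣ d := by
    have hv : (!![1 - j, j; 1, -1 + j]).mulVec ![1, -1] = (1 + j) • ![1, -1] := by
      ext i
      fin_cases i
      · simp [Matrix.mulVec, dotProduct]; linear_combination -j * h3
      · simp [Matrix.mulVec, dotProduct]; linear_combination h3
    have h := restrictLine_linSubst ![1, -1] _ _ hv q
    rw [hq₁] at h
    replace h := congrArg (Polynomial.coeff · d) h
    simp only [Polynomial.comp_C_mul_X_coeff] at h
    have hpow : (1 + j) ^ d = 1 := mul_left_cancel₀ hd (by rw [← h, mul_one])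
    have h4 : (1 + j) ^ 4 = -1 := by grind
    have hord : orderOf (1 + j) = 2 ^ (2 + 1) := by
      apply orderOf_eq_prime_pow
      · norm_num [h4]
        intro h
        exact one_ne_zero (α := K) (by linear_combination h3 + h)
      · rw [pow_succ 2 2, pow_mul]; norm_num [h4]
    simpa [hord] using orderOf_dvd_of_pow_eq_one hpow
  have hthree : 3 ∣ d := by
    have h := derivative_restrictLine_eq_zero ![1, -1] ![1, 0] !![-1, 1; -1, 0]
      (by
        ext i
        fin_cases i <;> simp [Matrix.mulVec, dotProduct]
        linear_combination -h3)
      (by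
        ext i
        fin_cases i <;> simp [Matrix.mulVec, dotProduct]
        linear_combination -h3) q hq₂
    rcases d with _ | d
    · simp
    replace h := congrArg (Polynomial.coeff · d) h
    simp only [Polynomial.coeff_derivative, Polynomial.coeff_zero, mul_eq_zero, hd,
      false_or] at h
    exact (CharP.cast_eq_zero_iff K 3 (d + 1)).1 (by exact_mod_cast h)
  omega

section Matrices

theorem ofReal_sqrt_two_sq : ((Real.sqrt 2 : ℝ) : ℂ) ^ 2 = 2 := by
  rw [← ofReal_pow, Real.sq_sqrt (by norm_num)]; norm_num

theorem ofReal_sqrt_two_ne_zero : ((Real.sqrt 2 : ℝ) : ℂ) ≠ 0 := by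
  simp

theorem ε_eq : ε = ((Real.sqrt 2 : ℝ) : ℂ)⁻¹ * (1 + I) := by
  have h : (Real.pi * I / 4 : ℂ) = ((Real.pi / 4 : ℝ) : ℂ) * I := by push_cast; ring
  rw [ε, h, exp_mul_I, ← ofReal_cos, ← ofReal_sin, Real.cos_pi_div_four, Real.sin_pi_div_four]
  have := ofReal_sqrt_two_sq
  have := ofReal_sqrt_two_ne_zero
  push_cast
  field_simp
  grind

theorem ε_sq : ε ^ 2 = I := by
  have h := ofReal_sqrt_two_sq
  have h0 := ofReal_sqrt_two_ne_zero
  rw [ε_eq]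
  field_simp
  rw [h]
  linear_combination I_sq

theorem I_mem_Rring : I ∈ Rring := by
  rw [← ε_sq]
  exact pow_mem (Subring.subset_closure (by simp)) 2

/-- The imaginary unit as an element of `R`. -/
noncomputable def iR : Rring := ⟨I, I_mem_Rring⟩

theorem iR_sq : iR ^ 2 = -1 := Subtype.ext (by simp [iR])

theorem isUnit_det_Umat : IsUnit Umat.det := by
  have h0 := ofReal_sqrt_two_ne_zero
  have hI : (1 - I : ℂ) ≠ 0 := fun h => by simpa using congrArg re h
  rw [isUnit_iff_ne_zero, Umat, Matrix.det_smul, Matrix.det_fin_two_of]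
  simpa [sub_eq_add_neg] using hI

theorem reflection_eq : Umat * (ε • Smat) * Umat⁻¹ = !![1, -1 + I; 1, -1] := by
  suffices h : Umat * (ε • Smat) = !![1, -1 + I; 1, -1] * Umat by
    rw [h, Matrix.mul_nonsing_inv_cancel_right _ _ isUnit_det_Umat]
  have h := ofReal_sqrt_two_sq
  have h0 := ofReal_sqrt_two_ne_zero
  have hI := I_sq
  rw [ε_eq]
  ext i j
  fin_cases i <;> fin_cases j <;>
    simp [Umat, Smat, Matrix.mul_apply, Fin.sum_univ_two] <;> field_simp <;> grind

theorem rotation_eq : Umat * Tmat * Umat⁻¹ = !![0, 1; -1, 1] := by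
  suffices h : Umat * Tmat = !![0, 1; -1, 1] * Umat by
    rw [h, Matrix.mul_nonsing_inv_cancel_right _ _ isUnit_det_Umat]
  have h := ofReal_sqrt_two_sq
  have h0 := ofReal_sqrt_two_ne_zero
  have hI := I_sq
  ext i j
  fin_cases i <;> fin_cases j <;>
    simp [Umat, Tmat, Matrix.mul_apply, Fin.sum_univ_two, ε_eq] <;> field_simp <;> grind

theorem exists_mem_G8_reflection :
    ∃ g ∈ G8, (g : Matrix (Fin 2) (Fin 2) ℂ) = !![1, -1 + I; 1, -1] :=
  ⟨Matrix.GeneralLinearGroup.mkOfDetNeZero !![1, -1 + I; 1, -1] (by simp [Matrix.det_fin_two_of]),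
    Subgroup.subset_closure (Or.inl (by rw [reflection_eq]; rfl)), rfl⟩

theorem exists_mem_G8_rotation :
    ∃ g ∈ G8, (g : Matrix (Fin 2) (Fin 2) ℂ) = !![0, 1; -1, 1] :=
  ⟨Matrix.GeneralLinearGroup.mkOfDetNeZero !![0, 1; -1, 1] (by simp [Matrix.det_fin_two_of]),
    Subgroup.subset_closure (Or.inr (by rw [rotation_eq]; rfl)), rfl⟩

theorem actC_eq_self_of_mem {p : MvPolynomial (Fin 2) ℂ}
    (hA : actC !![1, -1 + I; 1, -1] p = p) (hB : actC !![0, 1; -1, 1] p = p)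
    {g : GL (Fin 2) ℂ} (hg : g ∈ G8) : actC (g : Matrix (Fin 2) (Fin 2) ℂ) p = p := by
  simp only [actC_eq_linSubst] at *
  induction hg using Subgroup.closure_induction with
  | mem g hg =>
    rcases hg with hg | hg
    · exact (congrArg (linSubst · p) (hg.trans reflection_eq)).trans hA
    · exact (congrArg (linSubst · p) (hg.trans rotation_eq)).trans hB
  | one => simp [linSubst_one]
  | mul g h _ _ hg hh =>
    rw [Units.val_mul, ← linSubst_comp, AlgHom.comp_apply, hg, hh]
  | inv g _ hg =>
    conv_lhs => rw [← hg, ← AlgHom.comp_apply, linSubst_comp, Units.mul_inv, linSubst_one]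
    rfl

theorem mem_invariantRingC_G8_iff (q : MvPolynomial (Fin 2) ℂ) :
    q ∈ invariantRingC Rring G8 ↔
      (∃ p : MvPolynomial (Fin 2) Rring, map (algebraMap Rring ℂ) p = q) ∧
        ∀ g ∈ G8, actC (g : Matrix (Fin 2) (Fin 2) ℂ) q = q := by
  simp only [invariantRingC, Algebra.mem_inf, Subalgebra.mem_restrictScalars, Algebra.mem_iInf,
    AlgHom.mem_equalizer]
  rfl

end Matrices

theorem three_not_isUnit : ¬ IsUnit (3 : Rring) := by
  rintro ⟨u, hu⟩
  have hle : ∀ z ∈ Rring, IsIntegral ℤ z := by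
    intro z hz
    induction hz using Subring.closure_induction with
    | mem z hz =>
      rcases hz with rfl | rfl
      · refine IsIntegral.of_pow (n := 4) (by norm_num) ?_
        have : ε ^ 4 = -1 := by rw [show (4 : ℕ) = 2 * 2 from rfl, pow_mul, ε_sq, I_sq]
        rw [this]
        exact isIntegral_one.neg
      · refine IsIntegral.of_pow (n := 3) (by norm_num) ?_
        have : ω ^ 3 = 1 := by
          rw [ω, ← exp_nat_mul, ← exp_two_pi_mul_I]
          congr 1
          push_cast
          ring
        rw [this]
        exact isIntegral_one
    | zero => exact isIntegral_zero
    | one => exact isIntegral_one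
    | add _ _ _ _ hx hy => exact hx.add hy
    | neg _ _ hx => exact hx.neg
    | mul _ _ _ _ hx hy => exact hx.mul hy
  have hmul : (3 : ℂ) * ((u⁻¹ : Rringˣ) : Rring) = 1 := by
    have h : (3 : Rring) * (u⁻¹ : Rringˣ) = 1 := by rw [← hu, u.mul_inv]
    exact congrArg Subtype.val h
  have h_int := hle _ ((u⁻¹ : Rringˣ) : Rring).2
  have hval : (((u⁻¹ : Rringˣ) : Rring) : ℂ) = algebraMap ℚ ℂ (1 / 3) := by
    rw [map_div₀, map_one, map_ofNat, eq_div_iff (by norm_num), mul_comm, hmul]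
  rw [hval, isIntegral_algebraMap_iff (algebraMap ℚ ℂ).injective] at h_int
  obtain ⟨n, hn⟩ := IsIntegrallyClosed.isIntegral_iff.1 h_int
  have h1 : (3 * n : ℚ) = 1 := by
    rw [eq_intCast] at hn
    rw [hn]; norm_num
  have h2 : 3 * n = 1 := by exact_mod_cast h1
  omega

/-- Let `A` be an augmented algebra over a domain, isomorphic to a polynomial ring. If a nonzero
multiple of `F` lies in the square of the augmentation ideal, then so does `F`; in particular every
homomorphism taking the augmentation ideal into `I` takes `F` into `I ^ 2`. -/
theorem map_mem_sq_of_smul_mem_sq_ker {R A S : Type*} [CommRing R] [IsDomain R] [CommRing A]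
    [Algebra R A] [CommRing S] (η : A →ₐ[R] R) (ψ : A →+* S) (I : Ideal S)
    (hψ : ∀ a, η a = 0 → ψ a ∈ I) {F : A} {c : R} (hc : c ≠ 0)
    (hF : c • F ∈ RingHom.ker η ^ 2) {σ : Type*} (e : A ≃ₐ[R] MvPolynomial σ R) :
    ψ F ∈ I ^ 2 := by
  set r : σ → R := fun i => η (e.symm (X i))
  let shift : MvPolynomial σ R ≃ₐ[R] MvPolynomial σ R :=
    AlgEquiv.ofAlgHom (aeval fun i => X i + C (r i)) (aeval fun i => X i - C (r i))
      (by ext1 i; simp [algHom_C]) (by ext1 i; simp [algHom_C])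
  let e' := e.trans shift
  have hX (i : σ) : η (e'.symm (X i)) = 0 := by
    change η (e.symm (aeval (fun i => X i - C (r i)) (X i))) = 0
    have hC : e.symm (C (r i)) = algebraMap R A (r i) := e.symm.commutes (r i)
    rw [aeval_X, map_sub, map_sub, hC, η.commutes]
    simp [r]
  have hη : η.comp (e'.symm : MvPolynomial σ R →ₐ[R] A) = aeval (fun _ => (0 : R)) := by
    ext1 i
    simpa using hX i
  have hker : (RingHom.ker η).map e' ≤ idealOfVars σ R := by
    rw [Ideal.map_le_iff_le_comap]
    intro a ha
    have h := DFunLike.congr_fun hη (e' a)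
    rw [AlgHom.comp_apply, AlgEquiv.coe_toAlgHom, AlgEquiv.symm_apply_apply,
      (RingHom.mem_ker).1 ha] at h
    rw [Ideal.mem_comap, ← pow_one (idealOfVars σ R), mem_pow_idealOfVars_iff']
    intro x hx
    obtain rfl : x = 0 := by simpa [Finsupp.degree_eq_zero_iff] using hx
    simpa [aeval_zero', constantCoeff_eq] using h.symm
  have hsmul : c • e' F ∈ idealOfVars σ R ^ 2 := by
    rw [← map_smul]
    refine Ideal.pow_right_mono hker 2 ?_
    rw [← Ideal.map_pow]
    exact Ideal.mem_map_of_mem e' hF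
  have hmem : e' F ∈ idealOfVars σ R ^ 2 := by
    rw [mem_pow_idealOfVars_iff'] at hsmul ⊢
    intro x hx
    simpa [hc] using hsmul x hx
  have hle : (idealOfVars σ R).map (ψ.comp (e'.symm : MvPolynomial σ R →+* A)) ≤ I := by
    rw [Ideal.map_le_iff_le_comap, idealOfVars, Ideal.span_le]
    rintro _ ⟨i, rfl⟩
    exact hψ _ (hX i)
  have h := Ideal.pow_right_mono hle 2
    (by rw [← Ideal.map_pow]; exact Ideal.mem_map_of_mem _ hmem)
  simpa using h

section InvariantRing

theorem map_algebraMap_injective :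
    Function.Injective (map (σ := Fin 2) (algebraMap Rring ℂ)) :=
  map_injective _ Subtype.val_injective

/-- The inclusion of the invariant ring into `R[x, y]`. -/
noncomputable def invariantLift :
    invariantRingC Rring G8 →ₐ[Rring] MvPolynomial (Fin 2) Rring :=
  ((AlgEquiv.ofInjective (MvPolynomial.mapAlgHom (R := Rring) (σ := Fin 2)
    (Algebra.ofId Rring ℂ)) map_algebraMap_injective).symm :
      _ →ₐ[Rring] MvPolynomial (Fin 2) Rring).comp (Subalgebra.inclusion inf_le_left)

theorem map_invariantLift (a : invariantRingC Rring G8) :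
    map (algebraMap Rring ℂ) (invariantLift a) = a :=
  congrArg Subtype.val ((AlgEquiv.ofInjective (MvPolynomial.mapAlgHom (R := Rring) (σ := Fin 2)
    (Algebra.ofId Rring ℂ)) map_algebraMap_injective).apply_symm_apply
      (Subalgebra.inclusion inf_le_left a))

theorem linSubst_invariantLift (a : invariantRingC Rring G8) {g : GL (Fin 2) ℂ} (hg : g ∈ G8)
    (M : Matrix (Fin 2) (Fin 2) Rring)
    (hM : (g : Matrix (Fin 2) (Fin 2) ℂ) = M.map (algebraMap Rring ℂ)) :
    linSubst M (invariantLift a) = invariantLift a := by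
  apply map_algebraMap_injective
  rw [map_linSubst, map_invariantLift, ← hM]
  exact ((mem_invariantRingC_G8_iff _).1 a.2).2 g hg

theorem dvd_of_coeff_restrictLine_invariantLift_ne_zero {K : Type*} [Field K]
    (h3 : (3 : K) = 0) (φ : Rring →+* K) (a : invariantRingC Rring G8) {d : ℕ}
    (hd : (restrictLine ![1, -1] (map φ (invariantLift a))).coeff d ≠ 0) : 24 ∣ d := by
  obtain ⟨A, hA, hA'⟩ := exists_mem_G8_reflection
  obtain ⟨B, hB, hB'⟩ := exists_mem_G8_rotation
  have hj : φ iR ^ 2 = -1 := by rw [← map_pow, iR_sq, map_neg, map_one]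
  have hI : algebraMap Rring ℂ iR = I := rfl
  have hII := I_sq
  refine dvd_of_coeff_restrictLine_ne_zero h3 hj ?_ ?_ hd
  · have h := linSubst_invariantLift a
      (mul_mem (mul_mem (mul_mem (mul_mem (mul_mem hA hB) hB) hA) hB) hA)
      !![1 - iR, iR; 1, -1 + iR] (by
        simp only [Units.val_mul, hA', hB', Matrix.mul_fin_two]
        ext i j
        fin_cases i <;> fin_cases j <;> simp [hI] <;> grind)
    conv_rhs => rw [← h]
    rw [map_linSubst]
    congr 2
    ext i j
    fin_cases i <;> fin_cases j <;> simp
  · have h := linSubst_invariantLift a (mul_mem hB hB) !![-1, 1; -1, 0] (by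
        simp only [Units.val_mul, hB', Matrix.mul_fin_two]
        ext i j
        fin_cases i <;> fin_cases j <;> simp)
    conv_rhs => rw [← h]
    rw [map_linSubst]
    congr 2
    ext i j
    fin_cases i <;> fin_cases j <;> simp

theorem C_I_sq : (C I : MvPolynomial (Fin 2) ℂ) ^ 2 = -1 := by
  rw [← C_pow, I_sq, C_neg, C_1]

theorem octicForm_mem : octicForm (C I) (X 0) (X 1) ∈ invariantRingC Rring G8 := by
  refine (mem_invariantRingC_G8_iff _).2 ⟨⟨octicForm (C iR) (X 0) (X 1), ?_⟩,
    fun g hg => actC_eq_self_of_mem ?_ ?_ hg⟩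
  · rw [map_octicForm, map_C, map_X, map_X]
    rfl
  · refine Eq.trans ?_ (octicForm_reflection C_I_sq _ _)
    rw [← RingHom.coe_coe, map_octicForm]
    simp [actC_eq_linSubst, algHom_C, sub_eq_add_neg]
  · refine Eq.trans ?_ (octicForm_rotation _ _ _)
    rw [← RingHom.coe_coe, map_octicForm]
    simp [actC_eq_linSubst, algHom_C]

theorem duodecicForm_mem : duodecicForm (C I) (X 0) (X 1) ∈ invariantRingC Rring G8 := by
  refine (mem_invariantRingC_G8_iff _).2 ⟨⟨duodecicForm (C iR) (X 0) (X 1), ?_⟩,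
    fun g hg => actC_eq_self_of_mem ?_ ?_ hg⟩
  · rw [map_duodecicForm, map_C, map_X, map_X]
    rfl
  · refine Eq.trans ?_ (duodecicForm_reflection C_I_sq _ _)
    rw [← RingHom.coe_coe, map_duodecicForm]
    simp [actC_eq_linSubst, algHom_C, sub_eq_add_neg]
  · refine Eq.trans ?_ (duodecicForm_rotation _ _ _)
    rw [← RingHom.coe_coe, map_duodecicForm]
    simp [actC_eq_linSubst, algHom_C]

theorem sexticForm_pow_mem : sexticForm (C I) (X 0) (X 1) ^ 4 ∈ invariantRingC Rring G8 := by
  have hrel (M : Matrix (Fin 2) (Fin 2) ℂ)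
      (h₁ : actC M (octicForm (C I) (X 0) (X 1)) = octicForm (C I) (X 0) (X 1))
      (h₂ : actC M (duodecicForm (C I) (X 0) (X 1)) = duodecicForm (C I) (X 0) (X 1)) :
      actC M (sexticForm (C I) (X 0) (X 1) ^ 4) = sexticForm (C I) (X 0) (X 1) ^ 4 := by
    have h := sexticForm_relation C_I_sq (X 0) (X 1)
    have h' := congrArg (actC M) h
    rw [map_sub, map_mul, map_mul, map_pow _ (duodecicForm _ _ _), map_pow _ (octicForm _ _ _),
      h₁, h₂, map_neg, map_ofNat, map_ofNat, ← h] at h'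
    exact mul_left_cancel₀ (by norm_num) h'
  refine (mem_invariantRingC_G8_iff _).2 ⟨⟨sexticForm (C iR) (X 0) (X 1) ^ 4, ?_⟩,
    fun g hg => hrel _ (((mem_invariantRingC_G8_iff _).1 octicForm_mem).2 g hg)
      (((mem_invariantRingC_G8_iff _).1 duodecicForm_mem).2 g hg)⟩
  rw [map_pow, map_sexticForm, map_C, map_X, map_X]
  rfl

end InvariantRing

/-- the ring of invariants `R[x, y]^{G₈}` (with `R = ℤ[ε, ω]`) is not
isomorphic to a polynomial ring over `R`. -/
theorem G8_invariants_not_polynomial :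
    ¬ ∃ k : ℕ, Nonempty (↥(invariantRingC Rring G8) ≃ₐ[↥Rring] MvPolynomial (Fin k) ↥Rring) := by
  rintro ⟨k, ⟨e⟩⟩
  obtain ⟨m, hm, h3m⟩ := exists_max_ideal_of_mem_nonunits
    (show (3 : Rring) ∈ nonunits Rring from three_not_isUnit)
  let _ := Ideal.Quotient.field m
  let φ : Rring →+* Rring ⧸ m := Ideal.Quotient.mk m
  have h3 : (3 : Rring ⧸ m) = 0 := by
    rw [← map_ofNat φ 3]
    exact Ideal.Quotient.eq_zero_iff_mem.2 h3m
  let G : invariantRingC Rring G8 := ⟨_, octicForm_mem⟩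
  let H : invariantRingC Rring G8 := ⟨_, duodecicForm_mem⟩
  let F : invariantRingC Rring G8 := ⟨_, sexticForm_pow_mem⟩
  have hG : invariantLift G = octicForm (C iR) (X 0) (X 1) := by
    apply map_algebraMap_injective
    rw [map_invariantLift, map_octicForm, map_C, map_X, map_X]
    rfl
  have hH : invariantLift H = duodecicForm (C iR) (X 0) (X 1) := by
    apply map_algebraMap_injective
    rw [map_invariantLift, map_duodecicForm, map_C, map_X, map_X]
    rfl
  have hF : invariantLift F = sexticForm (C iR) (X 0) (X 1) ^ 4 := by
    apply map_algebraMap_injective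
    rw [map_invariantLift, map_pow, map_sexticForm, map_C, map_X, map_X]
    rfl
  let η : invariantRingC Rring G8 →ₐ[Rring] Rring :=
    (aeval (fun _ => (0 : Rring))).comp invariantLift
  have hη (a) : η a = constantCoeff (invariantLift a) := by simp [η]
  let ψ : invariantRingC Rring G8 →+* Polynomial (Rring ⧸ m) :=
    ((restrictLine ![1, -1]).toRingHom.comp (map φ)).comp invariantLift.toRingHom
  have hψ (a : invariantRingC Rring G8) (ha : η a = 0) :
      ψ a ∈ Ideal.span {(Polynomial.X : Polynomial (Rring ⧸ m)) ^ 24} := by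
    rw [Ideal.mem_span_singleton, Polynomial.X_pow_dvd_iff]
    intro d hd
    by_contra hne
    have h24 := dvd_of_coeff_restrictLine_invariantLift_ne_zero h3 φ a hne
    obtain rfl := Nat.eq_zero_of_dvd_of_lt h24 hd
    apply hne
    have hcc (q : MvPolynomial (Fin 2) (Rring ⧸ m)) :
        (restrictLine ![1, -1] q).coeff 0 = constantCoeff q := by
      induction q using MvPolynomial.induction_on with
      | C a => simp [algHom_C]
      | add p q hp hq => simp [hp, hq]
      | mul_X p i hp => simp
    change (restrictLine ![1, -1] (map φ (invariantLift a))).coeff 0 = 0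
    rw [hcc, constantCoeff_map, ← hη, ha, map_zero]
  have hrel : (-27 : Rring) • F = H ^ 2 - 4 * G ^ 3 := by
    rw [Algebra.smul_def, map_neg, map_ofNat]
    exact Subtype.ext (sexticForm_relation C_I_sq (X 0) (X 1))
  have hGker : G ∈ RingHom.ker η := by
    rw [RingHom.mem_ker, hη, hG, map_octicForm]
    simp [octicForm]
  have hHker : H ∈ RingHom.ker η := by
    rw [RingHom.mem_ker, hη, hH, map_duodecicForm]
    simp [duodecicForm]
  have hFker : (-27 : Rring) • F ∈ RingHom.ker η ^ 2 := by
    rw [hrel]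
    refine sub_mem (Ideal.pow_mem_pow hHker 2) (Ideal.mul_mem_left _ _ ?_)
    exact Ideal.pow_le_pow_right (by norm_num) (Ideal.pow_mem_pow hGker 3)
  have h := map_mem_sq_of_smul_mem_sq_ker η ψ _ hψ (by norm_num) hFker e
  rw [Ideal.span_singleton_pow, Ideal.mem_span_singleton, ← pow_mul,
    Polynomial.X_pow_dvd_iff] at h
  have hj : φ iR ^ 2 = -1 := by rw [← map_pow, iR_sq, map_neg, map_one]
  have hψF : ψ F = - Polynomial.X ^ 24 := by
    change restrictLine ![1, -1] (map φ (invariantLift F)) = _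
    rw [hF, map_pow, map_pow, map_sexticForm, map_C, map_X, map_X, ← RingHom.coe_coe,
      map_sexticForm]
    have h3' : (3 : Polynomial (Rring ⧸ m)) = 0 := by
      rw [← map_ofNat Polynomial.C 3, h3, map_zero]
    have hj' : (Polynomial.C (φ iR)) ^ 2 = -1 := by
      rw [← Polynomial.C_pow, hj, Polynomial.C_neg, Polynomial.C_1]
    simp only [RingHom.coe_coe, restrictLine_X, algHom_C, Polynomial.algebraMap_eq,
      Matrix.cons_val_zero, Matrix.cons_val_one, Polynomial.C_1, Polynomial.C_neg, sexticForm]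
    grind
  have h24 := h 24 (by norm_num)
  rw [hψF] at h24
  simp at h24
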